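/- arXiv:2209.07157 — 8 statements merged into one kernel-verified Lean document; each statement's English description precedes it below -/
import Mathlib

section
/- Let n, k ≥ 1, A ∈ ℝ^{n×k}, b ∈ ℝ^n, let V ∈ ℝ^{n×n} and Σ ∈ ℝ^{k×k} be symmetric positive definite, and let μ ∈ ℝ^k. Then for every x ∈ ℝ^n, ∫_{ℝ^k} N(x; Aθ + b, V) · N(θ; μ, Σ) dθ = N(x; Aμ + b, V + AΣAᵀ). -/
open MeasureTheory Matrix Real

/-- The multivariate Gaussian density `N(x; μ, S)` on `ℝ^m`. -/
noncomputable def gaussian {m : ℕ} (x μ : Fin m → ℝ) (S : Matrix (Fin m) (Fin m) ℝ) : ℝ :=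
  (((2 * Real.pi) • S).det) ^ (-(1 : ℝ) / 2) *
    Real.exp (-(1 / 2) * ((x - μ) ⬝ᵥ (S⁻¹ *ᵥ (x - μ))))

lemma Matrix.PosDef.exists_eq_transpose_mul_self {m : ℕ} {M : Matrix (Fin m) (Fin m) ℝ}
    (hM : M.PosDef) : ∃ B : Matrix (Fin m) (Fin m) ℝ, M = Bᵀ * B := by
  open scoped MatrixOrder in
  obtain ⟨B, hB⟩ := CStarAlgebra.nonneg_iff_eq_star_mul_self.mp hM.posSemidef.nonneg
  exact ⟨B, by simpa [star_eq_conjTranspose] using hB⟩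

lemma integral_exp_neg_half_dotProduct_self (m : ℕ) :
    ∫ u : Fin m → ℝ, Real.exp (-(1 / 2) * (u ⬝ᵥ u)) = ((2 * π) ^ m) ^ ((1 : ℝ) / 2) := by
  have h : ∀ u : Fin m → ℝ, Real.exp (-(1 / 2) * (u ⬝ᵥ u)) =
      ∏ i, Real.exp (-(1 / 2) * u i ^ 2) := fun u ↦ by
    rw [← Real.exp_sum, dotProduct, Finset.mul_sum]
    simp only [sq]
  simp_rw [h]
  rw [integral_fintype_prod_volume_eq_prod (fun _ (v : ℝ) ↦ Real.exp (-(1 / 2) * v ^ 2)),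
    Finset.prod_const, integral_gaussian, Finset.card_univ, Fintype.card_fin,
    Real.sqrt_eq_rpow, ← Real.rpow_natCast, ← Real.rpow_natCast, ← Real.rpow_mul (by positivity),
    ← Real.rpow_mul (by positivity), mul_comm (m : ℝ)]
  congr 1
  ring

lemma Matrix.PosDef.integral_exp_neg_half_quadratic {m : ℕ} {M : Matrix (Fin m) (Fin m) ℝ}
    (hM : M.PosDef) :
    ∫ s : Fin m → ℝ, Real.exp (-(1 / 2) * (s ⬝ᵥ (M *ᵥ s))) =
      ((2 * π) ^ m) ^ ((1 : ℝ) / 2) * M.det ^ (-(1 : ℝ) / 2) := by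
  obtain ⟨B, rfl⟩ := hM.exists_eq_transpose_mul_self
  have hdet : (Bᵀ * B).det = |B.det| ^ 2 := by
    rw [det_mul, det_transpose, sq_abs, sq]
  have hB : B.det ≠ 0 := fun h ↦ by
    have := hM.det_pos
    simp [hdet, h] at this
  have hq : ∀ s : Fin m → ℝ, s ⬝ᵥ ((Bᵀ * B) *ᵥ s) = (toLin' B s) ⬝ᵥ (toLin' B s) := fun s ↦ by
    rw [← mulVec_mulVec, dotProduct_mulVec, vecMul_transpose, toLin'_apply]
  have hc : Continuous (toLin' B) := LinearMap.continuous_of_finiteDimensional _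
  simp_rw [hq]
  rw [← integral_map (φ := toLin' B) (f := fun u : Fin m → ℝ ↦ Real.exp (-(1 / 2) * (u ⬝ᵥ u)))
    hc.aemeasurable (Continuous.aestronglyMeasurable (by unfold dotProduct; fun_prop)),
    Real.map_matrix_volume_pi_eq_smul_volume_pi hB, integral_smul_measure,
    integral_exp_neg_half_dotProduct_self, ENNReal.toReal_ofReal (abs_nonneg _), smul_eq_mul,
    mul_comm, hdet, ← Real.rpow_natCast, ← Real.rpow_natCast, ← Real.rpow_mul (abs_nonneg _),
    abs_inv]
  congr 1
  rw [← Real.rpow_neg_one]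
  norm_num

/-- Completing the square in `θ`, with `θ = s + S Aᵀ w` and `x - A μ - b = (V + A S Aᵀ) w`. -/
lemma quadratic_add_quadratic_eq {n k : ℕ} (A : Matrix (Fin n) (Fin k) ℝ)
    {V : Matrix (Fin n) (Fin n) ℝ} (hV : V.PosDef) {S : Matrix (Fin k) (Fin k) ℝ} (hS : S.PosDef)
    (w : Fin n → ℝ) (s : Fin k → ℝ) :
    (V *ᵥ w - A *ᵥ s) ⬝ᵥ (V⁻¹ *ᵥ (V *ᵥ w - A *ᵥ s)) +
        (s + S *ᵥ (Aᵀ *ᵥ w)) ⬝ᵥ (S⁻¹ *ᵥ (s + S *ᵥ (Aᵀ *ᵥ w))) =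
      s ⬝ᵥ ((S⁻¹ + Aᵀ * V⁻¹ * A) *ᵥ s) + w ⬝ᵥ ((V + A * S * Aᵀ) *ᵥ w) := by
  have hVt : Vᵀ = V := by simpa using hV.isHermitian.eq
  have hSt : Sᵀ = S := by simpa using hS.isHermitian.eq
  have hV1 : V⁻¹ * V = 1 := nonsing_inv_mul _ hV.det_pos.ne'.isUnit
  have hS1 : S⁻¹ * S = 1 := nonsing_inv_mul _ hS.det_pos.ne'.isUnit
  have hV2 : V * V⁻¹ = 1 := mul_nonsing_inv _ hV.det_pos.ne'.isUnit
  have hS2 : S * S⁻¹ = 1 := mul_nonsing_inv _ hS.det_pos.ne'.isUnit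
  have e1 : ∀ z, V⁻¹ *ᵥ (V *ᵥ z) = z := fun z ↦ by simp [mulVec_mulVec, hV1]
  have e2 : ∀ z, S⁻¹ *ᵥ (S *ᵥ z) = z := fun z ↦ by simp [mulVec_mulVec, hS1]
  have e3 : ∀ z z', (V *ᵥ z) ⬝ᵥ (V⁻¹ *ᵥ z') = z ⬝ᵥ z' := fun z z' ↦ by
    rw [dotProduct_comm, dotProduct_comm z, dotProduct_mulVec, ← mulVec_transpose, hVt,
      mulVec_mulVec, hV2, one_mulVec]
  have e4 : ∀ z z', (S *ᵥ z) ⬝ᵥ (S⁻¹ *ᵥ z') = z ⬝ᵥ z' := fun z z' ↦ by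
    rw [dotProduct_comm, dotProduct_comm z, dotProduct_mulVec, ← mulVec_transpose, hSt,
      mulVec_mulVec, hS2, one_mulVec]
  have e5 : ∀ (z : Fin k → ℝ) z', z ⬝ᵥ (Aᵀ *ᵥ z') = (A *ᵥ z) ⬝ᵥ z' := fun z z' ↦ by
    rw [dotProduct_mulVec, vecMul_transpose]
  have e6 : ∀ (z : Fin k → ℝ) z', z' ⬝ᵥ (A *ᵥ z) = (Aᵀ *ᵥ z') ⬝ᵥ z := fun z z' ↦ by
    rw [dotProduct_mulVec, mulVec_transpose]
  simp only [mulVec_sub, mulVec_add, sub_dotProduct, add_dotProduct, dotProduct_sub,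
    dotProduct_add, add_mulVec, ← mulVec_mulVec, e1, e2, e3, e4]
  rw [e5 s w, e5 s, e6 _ w, e6 _ w, dotProduct_comm w (V *ᵥ w), dotProduct_comm (Aᵀ *ᵥ w) s,
    e5 s w, dotProduct_comm (S *ᵥ _)]
  ring

lemma det_mul_det_mul_det_inv_add {n k : ℕ} (A : Matrix (Fin n) (Fin k) ℝ)
    {V : Matrix (Fin n) (Fin n) ℝ} (hV : V.PosDef) {S : Matrix (Fin k) (Fin k) ℝ} (hS : S.PosDef) :
    V.det * S.det * (S⁻¹ + Aᵀ * V⁻¹ * A).det = (V + A * S * Aᵀ).det := by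
  rw [det_add_mul _ _ hV.det_pos.ne'.isUnit, mul_assoc, mul_comm S.det, ← det_mul, add_mul,
    nonsing_inv_mul _ hS.det_pos.ne'.isUnit, ← Matrix.mul_assoc]

theorem gaussian_marginal
    (n k : ℕ) (hn : 1 ≤ n) (hk : 1 ≤ k)
    (A : Matrix (Fin n) (Fin k) ℝ) (b : Fin n → ℝ)
    (V : Matrix (Fin n) (Fin n) ℝ) (hV : V.PosDef)
    (S : Matrix (Fin k) (Fin k) ℝ) (hS : S.PosDef)
    (μ : Fin k → ℝ) :
    ∀ x : Fin n → ℝ,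
      (∫ θ : Fin k → ℝ, gaussian x (A *ᵥ θ + b) V * gaussian θ μ S) =
      gaussian x (A *ᵥ μ + b) (V + A * S * Aᵀ) := by
  intro x
  set W := V + A * S * Aᵀ with hW
  have hWpos : W.PosDef :=
    hV.add_posSemidef (by simpa using hS.posSemidef.mul_mul_conjTranspose_same A)
  have hMpos : (S⁻¹ + Aᵀ * V⁻¹ * A).PosDef :=
    hS.inv.add_posSemidef (by simpa using hV.inv.posSemidef.conjTranspose_mul_mul_same A)
  set w := W⁻¹ *ᵥ (x - (A *ᵥ μ + b)) with hw
  have hy : x - (A *ᵥ μ + b) = W *ᵥ w := by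
    rw [hw, mulVec_mulVec, mul_nonsing_inv _ hWpos.det_pos.ne'.isUnit, one_mulVec]
  have hshift (s : Fin k → ℝ) :
      gaussian x (A *ᵥ (s + (μ + S *ᵥ (Aᵀ *ᵥ w))) + b) V *
          gaussian (s + (μ + S *ᵥ (Aᵀ *ᵥ w))) μ S =
        ((((2 * π) • V).det) ^ (-(1 : ℝ) / 2) * (((2 * π) • S).det) ^ (-(1 : ℝ) / 2) *
          Real.exp (-(1 / 2) * (w ⬝ᵥ (W *ᵥ w)))) *
            Real.exp (-(1 / 2) * (s ⬝ᵥ ((S⁻¹ + Aᵀ * V⁻¹ * A) *ᵥ s))) := by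
    have h1 : x - (A *ᵥ (s + (μ + S *ᵥ (Aᵀ *ᵥ w))) + b) = V *ᵥ w - A *ᵥ s := by
      have : x = W *ᵥ w + (A *ᵥ μ + b) := by rw [← hy]; abel
      rw [this, hW]
      simp only [mulVec_add, add_mulVec, ← mulVec_mulVec]
      abel
    have h2 : s + (μ + S *ᵥ (Aᵀ *ᵥ w)) - μ = s + S *ᵥ (Aᵀ *ᵥ w) := by abel
    rw [gaussian, gaussian, h1, h2, mul_mul_mul_comm, ← Real.exp_add, ← mul_add,
      quadratic_add_quadratic_eq A hV hS, mul_add, Real.exp_add]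
    ring
  rw [← integral_add_right_eq_self _ (μ + S *ᵥ (Aᵀ *ᵥ w))]
  simp_rw [hshift]
  rw [integral_const_mul, hMpos.integral_exp_neg_half_quadratic, gaussian, ← hw, hy,
    dotProduct_comm (W *ᵥ w), det_smul, det_smul, det_smul, Fintype.card_fin, Fintype.card_fin,
    hW, ← det_mul_det_mul_det_inv_add A hV hS]
  have hdV := hV.det_pos.le
  have hdS := hS.det_pos.le
  have hdM := hMpos.det_pos.le
  have hc : (0 : ℝ) < (2 * π) ^ k := by positivity
  have hcancel : ((2 * π) ^ k) ^ (-(1 : ℝ) / 2) * ((2 * π) ^ k) ^ ((1 : ℝ) / 2) = 1 := by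
    rw [← Real.rpow_add hc]
    norm_num
  rw [Real.mul_rpow (by positivity) hdV, Real.mul_rpow (by positivity) hdS,
    Real.mul_rpow (by positivity) (by positivity), Real.mul_rpow (by positivity) hdM,
    Real.mul_rpow hdV hdS]
  linear_combination (((2 * π) ^ n) ^ (-(1 : ℝ) / 2) * V.det ^ (-(1 : ℝ) / 2) *
    S.det ^ (-(1 : ℝ) / 2) * (S⁻¹ + Aᵀ * V⁻¹ * A).det ^ (-(1 : ℝ) / 2) *
    Real.exp (-(1 / 2) * (w ⬝ᵥ ((V + A * S * Aᵀ) *ᵥ w)))) * hcancel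
end

section
/- Let K ≥ 1, 1 ≤ m < K, let V ∈ ℝ^{K×K} be symmetric positive definite, and let B ∈ ℝ^{K×m} have linearly independent columns. Then for every β > 0 the matrix V + β²BBᵀ is invertible, BᵀV⁻¹B is invertible, and lim_{β→∞} (V + β²BBᵀ)⁻¹ = V⁻¹ − V⁻¹B(BᵀV⁻¹B)⁻¹BᵀV⁻¹ (entrywise limit). -/
open MeasureTheory Matrix Real Filter

theorem limit_of_inflated_inverse
    (K m : ℕ) (hK : 1 ≤ K) (hm : 1 ≤ m) (hmK : m < K)
    (V : Matrix (Fin K) (Fin K) ℝ) (hV : V.PosDef)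
    (B : Matrix (Fin K) (Fin m) ℝ)
    (hB : LinearIndependent ℝ Bᵀ) :
    (∀ β : ℝ, 0 < β → IsUnit (V + β ^ 2 • (B * Bᵀ))) ∧
    IsUnit (Bᵀ * V⁻¹ * B) ∧
    Tendsto (fun β : ℝ => (V + β ^ 2 • (B * Bᵀ))⁻¹) atTop
      (nhds (V⁻¹ - V⁻¹ * B * (Bᵀ * V⁻¹ * B)⁻¹ * Bᵀ * V⁻¹)) := by
  have hS : (Bᵀ * V⁻¹ * B).PosDef := by
    simpa only [conjTranspose_eq_transpose_of_trivial] using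
      hV.inv.conjTranspose_mul_mul_same (B := B) (mulVec_injective_iff.mpr hB)
  have hBB : (B * Bᵀ).PosSemidef := by
    simpa only [conjTranspose_eq_transpose_of_trivial] using posSemidef_self_mul_conjTranspose B
  refine ⟨fun β _ => (hV.add_posSemidef (hBB.smul (sq_nonneg β))).isUnit, hS.isUnit, ?_⟩
  have woodbury : ∀ β : ℝ, 0 < β → (V + β ^ 2 • (B * Bᵀ))⁻¹ =
      V⁻¹ - V⁻¹ * B * ((β ^ 2)⁻¹ • 1 + Bᵀ * V⁻¹ * B)⁻¹ * Bᵀ * V⁻¹ := by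
    intro β hβ
    have hβ2 : 0 < β ^ 2 := by positivity
    have hC : IsUnit (β ^ 2 • (1 : Matrix (Fin m) (Fin m) ℝ)) := (PosDef.one.smul hβ2).isUnit
    have hC_inv : (β ^ 2 • (1 : Matrix (Fin m) (Fin m) ℝ))⁻¹ = (β ^ 2)⁻¹ • 1 :=
      inv_eq_left_inv (by simp [smul_smul, hβ.ne'])
    have hCS : IsUnit ((β ^ 2 • (1 : Matrix (Fin m) (Fin m) ℝ))⁻¹ + Bᵀ * V⁻¹ * B) := by
      rw [hC_inv]
      exact ((PosDef.one.smul (inv_pos.mpr hβ2)).add hS).isUnit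
    have h := add_mul_mul_inv_eq_sub V B _ Bᵀ hV.isUnit hC hCS
    rw [hC_inv] at h
    simpa using h
  have hlim : Tendsto (fun β : ℝ => (β ^ 2)⁻¹ • (1 : Matrix (Fin m) (Fin m) ℝ) + Bᵀ * V⁻¹ * B)
      atTop (nhds (Bᵀ * V⁻¹ * B)) := by
    have h : Tendsto (fun β : ℝ => (β ^ 2)⁻¹) atTop (nhds 0) :=
      (tendsto_pow_atTop two_ne_zero).inv_tendsto_atTop
    simpa using (h.smul_const (1 : Matrix (Fin m) (Fin m) ℝ)).add_const (Bᵀ * V⁻¹ * B)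
  have hinv : ContinuousAt Inv.inv (Bᵀ * V⁻¹ * B) := by
    refine continuousAt_matrix_inv _ ?_
    rw [Ring.inverse_eq_inv']
    exact continuousAt_inv₀ ((isUnit_iff_isUnit_det _).mp hS.isUnit).ne_zero
  have hcont : Continuous fun X : Matrix (Fin m) (Fin m) ℝ =>
      V⁻¹ - V⁻¹ * B * X * Bᵀ * V⁻¹ := by fun_prop
  refine ((hcont.tendsto _).comp (hinv.tendsto.comp hlim)).congr' ?_
  filter_upwards [eventually_gt_atTop 0] with β hβ
  exact (woodbury β hβ).symm
end

section
/- Let K ≥ 2, let λ ∈ ℝ^K have strictly positive entries, V := Diag(λ), and let x ∈ ℝ^K with x_K ≠ 0. Write x_{K−1} := (x₁, …, x_{K−1})ᵀ and V_{K−1} := Diag(λ₁, …, λ_{K−1}), and set B := [I_{K−1}; −x_K⁻¹ x_{K−1}ᵀ] ∈ ℝ^{K×(K−1)} (identity on the first K−1 rows, last row −x_K⁻¹ x_{K−1}ᵀ). Then BᵀV⁻¹B is invertible and (BᵀV⁻¹B)⁻¹ = V_{K−1} − (1/(xᵀVx)) · V_{K−1} x_{K−1} x_{K−1}ᵀ V_{K−1}.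 -/
open MeasureTheory Matrix Real

/-- The Sherman–Morrison identity for a rank-one update of an invertible diagonal matrix. -/
theorem diagonal_inv_add_smul_vecMulVec_mul {ι K : Type*} [Fintype ι] [DecidableEq ι] [Field K]
    (d y : ι → K) (hd : ∀ i, d i ≠ 0) (a s : K) (hs : s ≠ 0)
    (has : a * s = 1 + a * (y ⬝ᵥ (diagonal d *ᵥ y))) :
    (diagonal (fun i => (d i)⁻¹) + a • vecMulVec y y) *
      (diagonal d - s⁻¹ • vecMulVec (diagonal d *ᵥ y) (diagonal d *ᵥ y)) = 1 := by
  have h₁ : diagonal (fun i => (d i)⁻¹) * diagonal d = 1 := by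
    simp [diagonal_mul_diagonal, hd]
  have h₂ : diagonal (fun i => (d i)⁻¹) *ᵥ (diagonal d *ᵥ y) = y := by
    rw [mulVec_mulVec, h₁, one_mulVec]
  have h₃ : y ᵥ* diagonal d = diagonal d *ᵥ y := by
    rw [← mulVec_transpose, diagonal_transpose]
  have h₄ : a = s⁻¹ + a * s⁻¹ * (y ⬝ᵥ (diagonal d *ᵥ y)) := by
    field_simp
    linear_combination has
  rw [add_mul, mul_sub, mul_sub, h₁, Matrix.mul_smul, mul_vecMulVec, h₂, Matrix.smul_mul,
    Matrix.smul_mul, Matrix.mul_smul, vecMulVec_mul, h₃, vecMulVec_mul_vecMulVec]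
  ext i j
  simp only [Matrix.add_apply, Matrix.sub_apply, Matrix.smul_apply, vecMulVec_apply, smul_eq_mul,
    Pi.smul_apply]
  linear_combination (y i * (diagonal d *ᵥ y) j) * h₄

theorem BtVinvB_inverse
    (n : ℕ) (hn : 1 ≤ n)
    (lam : Fin (n + 1) → ℝ) (hlam : ∀ i, 0 < lam i)
    (x : Fin (n + 1) → ℝ) (hx : x (Fin.last n) ≠ 0)
    (B : Matrix (Fin (n + 1)) (Fin n) ℝ)
    (hB : ∀ (i : Fin (n + 1)) (j : Fin n),
      B i j = Fin.lastCases (-(x (Fin.last n))⁻¹ * x (Fin.castSucc j))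
        (fun i' : Fin n => if i' = j then (1 : ℝ) else 0) i) :
    IsUnit (Bᵀ * (Matrix.diagonal lam)⁻¹ * B) ∧
    (Bᵀ * (Matrix.diagonal lam)⁻¹ * B)⁻¹ =
      Matrix.diagonal (fun j : Fin n => lam (Fin.castSucc j)) -
        (x ⬝ᵥ (Matrix.diagonal lam *ᵥ x))⁻¹ •
          Matrix.vecMulVec
            ((Matrix.diagonal fun j : Fin n => lam (Fin.castSucc j)) *ᵥ
              fun j : Fin n => x (Fin.castSucc j))
            ((Matrix.diagonal fun j : Fin n => lam (Fin.castSucc j)) *ᵥ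
              fun j : Fin n => x (Fin.castSucc j)) := by
  have hM : Bᵀ * (Matrix.diagonal lam)⁻¹ * B =
      diagonal (fun j : Fin n => (lam j.castSucc)⁻¹) +
        (lam (Fin.last n) * x (Fin.last n) ^ 2)⁻¹ •
          vecMulVec (fun j : Fin n => x j.castSucc) (fun j : Fin n => x j.castSucc) := by
    have hinv : (diagonal lam)⁻¹ = diagonal (fun i => (lam i)⁻¹) :=
      inv_eq_left_inv (by simp [diagonal_mul_diagonal, (hlam _).ne'])
    ext i j
    rw [hinv, mul_apply, Fin.sum_univ_castSucc]
    simp only [mul_diagonal, transpose_apply, hB, Fin.lastCases_castSucc, Fin.lastCases_last,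
      Matrix.add_apply, Matrix.smul_apply, vecMulVec_apply, smul_eq_mul, diagonal_apply,
      ite_mul, mul_ite, one_mul, mul_one, zero_mul, mul_zero, Finset.sum_ite_eq', Finset.mem_univ,
      if_true]
    congr 1
    · rcases eq_or_ne i j with rfl | h
      · rfl
      · rw [if_neg h, if_neg h.symm]
    · ring
  have hq : x ⬝ᵥ (diagonal lam *ᵥ x) =
      (fun j : Fin n => x j.castSucc) ⬝ᵥ
        (diagonal (fun j : Fin n => lam j.castSucc) *ᵥ fun j : Fin n => x j.castSucc) +
      lam (Fin.last n) * x (Fin.last n) ^ 2 := by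
    simp only [dotProduct, mulVec_diagonal, Fin.sum_univ_castSucc]
    ring
  have hlast : 0 < lam (Fin.last n) * x (Fin.last n) ^ 2 := by
    have := hlam (Fin.last n)
    positivity
  have hnonneg : 0 ≤ (fun j : Fin n => x j.castSucc) ⬝ᵥ
      (diagonal (fun j : Fin n => lam j.castSucc) *ᵥ fun j : Fin n => x j.castSucc) := by
    simp only [dotProduct, mulVec_diagonal]
    refine Finset.sum_nonneg fun j _ => ?_
    rw [mul_left_comm]
    exact mul_nonneg (hlam _).le (mul_self_nonneg _)
  have hmul := diagonal_inv_add_smul_vecMulVec_mul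
    (fun j : Fin n => lam j.castSucc) (fun j : Fin n => x j.castSucc) (fun j => (hlam _).ne')
    (lam (Fin.last n) * x (Fin.last n) ^ 2)⁻¹ (x ⬝ᵥ (diagonal lam *ᵥ x))
    (by rw [hq]; positivity)
    (by rw [hq, mul_add, inv_mul_cancel₀ hlast.ne', add_comm])
  rw [← hM] at hmul
  exact ⟨IsUnit.of_mul_eq_one _ hmul, inv_eq_right_inv hmul⟩
end

section
/- Let K ≥ 2, let λ ∈ ℝ^K have strictly positive entries, V := Diag(λ), and let x ∈ ℝ^K with x_K ≠ 0. Write x_{K−1} := (x₁, …, x_{K−1})ᵀ and set B := [I_{K−1}; −x_K⁻¹ x_{K−1}ᵀ] ∈ ℝ^{K×(K−1)} (identity on the first K−1 rows, last row −x_K⁻¹ x_{K−1}ᵀ). Then V⁻¹ − V⁻¹B(BᵀV⁻¹B)⁻¹BᵀV⁻¹ = (1/(xᵀVx)) · x xᵀ. -/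
open MeasureTheory Matrix Real

/-- A matrix whose rows are orthogonal to the columns of `B` and to some vector `w` with
`x ⬝ᵥ w ≠ 0` vanishes, provided that vectors orthogonal to the columns of `B` are multiples
of `x`. -/
theorem Matrix.eq_zero_of_mul_eq_zero_of_mulVec_eq_zero {m k : Type*} [Fintype m]
    {B : Matrix m k ℝ} {x w : m → ℝ} (hB : ∀ d : m → ℝ, d ᵥ* B = 0 → ∃ c : ℝ, d = c • x)
    (hw : x ⬝ᵥ w ≠ 0) {D : Matrix m m ℝ} (hDB : D * B = 0) (hDw : D *ᵥ w = 0) : D = 0 := by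
  funext i
  obtain ⟨c, hc⟩ := hB (D i) (funext fun j => congrFun (congrFun hDB i) j)
  have h : D i ⬝ᵥ w = 0 := congrFun hDw i
  rw [hc, smul_dotProduct, smul_eq_mul] at h
  rw [hc, (mul_eq_zero.mp h).resolve_right hw, zero_smul]
  rfl

/-- The residual of a positive definite matrix after projecting on the columns of `B` has rank
one when the orthogonal complement of these columns is spanned by `x`. -/
theorem Matrix.PosDef.inv_sub_eq_smul_vecMulVec {m k : Type*} [Fintype m] [DecidableEq m]
    [Fintype k] [DecidableEq k] {V : Matrix m m ℝ} (hV : V.PosDef) {B : Matrix m k ℝ}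
    (hinj : Function.Injective B.mulVec) {x : m → ℝ} (hx : x ≠ 0) (hxB : x ᵥ* B = 0)
    (hB : ∀ d : m → ℝ, d ᵥ* B = 0 → ∃ c : ℝ, d = c • x) :
    V⁻¹ - V⁻¹ * B * (Bᵀ * V⁻¹ * B)⁻¹ * Bᵀ * V⁻¹ =
      (x ⬝ᵥ (V *ᵥ x))⁻¹ • Matrix.vecMulVec x x := by
  have hA : IsUnit (Bᵀ * V⁻¹ * B).det := by
    have h := hV.inv.conjTranspose_mul_mul_same hinj
    rw [conjTranspose_eq_transpose_of_trivial] at h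
    exact (isUnit_iff_isUnit_det _).mp h.isUnit
  have hVdet : IsUnit V.det := (isUnit_iff_isUnit_det _).mp hV.isUnit
  have hq : x ⬝ᵥ (V *ᵥ x) ≠ 0 := by
    simpa using (hV.dotProduct_mulVec_pos hx).ne'
  have hBx : Bᵀ *ᵥ x = 0 := by rw [mulVec_transpose, hxB]
  refine sub_eq_zero.mp (eq_zero_of_mul_eq_zero_of_mulVec_eq_zero hB hq ?_ ?_)
  · have h : V⁻¹ * B * (Bᵀ * V⁻¹ * B)⁻¹ * Bᵀ * V⁻¹ * B = V⁻¹ * B := by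
      rw [Matrix.mul_assoc _ V⁻¹ B, Matrix.mul_assoc _ Bᵀ, ← Matrix.mul_assoc Bᵀ,
        Matrix.mul_assoc, nonsing_inv_mul _ hA, Matrix.mul_one]
    rw [Matrix.sub_mul, Matrix.sub_mul, h, sub_self, smul_mul, vecMulVec_mul, hxB]
    ext i j
    simp [vecMulVec_apply]
  · have h : V⁻¹ *ᵥ (V *ᵥ x) = x := by
      rw [mulVec_mulVec, nonsing_inv_mul _ hVdet, one_mulVec]
    rw [sub_mulVec, sub_mulVec, ← mulVec_mulVec _ _ V⁻¹, h, ← mulVec_mulVec x _ Bᵀ, hBx,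
      mulVec_zero, smul_mulVec, vecMulVec_mulVec]
    ext i
    simp [hq]

theorem degenerate_precision_rank_one
    (n : ℕ) (hn : 1 ≤ n)
    (lam : Fin (n + 1) → ℝ) (hlam : ∀ i, 0 < lam i)
    (x : Fin (n + 1) → ℝ) (hx : x (Fin.last n) ≠ 0)
    (B : Matrix (Fin (n + 1)) (Fin n) ℝ)
    (hB : ∀ (i : Fin (n + 1)) (j : Fin n),
      B i j = Fin.lastCases (-(x (Fin.last n))⁻¹ * x (Fin.castSucc j))
        (fun i' : Fin n => if i' = j then (1 : ℝ) else 0) i) :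
    (Matrix.diagonal lam)⁻¹ -
        (Matrix.diagonal lam)⁻¹ * B * (Bᵀ * (Matrix.diagonal lam)⁻¹ * B)⁻¹ * Bᵀ *
          (Matrix.diagonal lam)⁻¹ =
      (x ⬝ᵥ (Matrix.diagonal lam *ᵥ x))⁻¹ • Matrix.vecMulVec x x := by
  have hvec : ∀ (d : Fin (n + 1) → ℝ) (j : Fin n), (d ᵥ* B) j =
      d j.castSucc - d (Fin.last n) * ((x (Fin.last n))⁻¹ * x j.castSucc) := by
    intro d j
    simp [vecMul, dotProduct, Fin.sum_univ_castSucc, hB, sub_eq_add_neg]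
  refine (PosDef.diagonal hlam).inv_sub_eq_smul_vecMulVec ?_ ?_ ?_ ?_
  · intro v w h
    funext j
    simpa [mulVec, dotProduct, hB] using congrFun h j.castSucc
  · rintro rfl
    exact hx rfl
  · funext j
    rw [hvec, mul_inv_cancel_left₀ hx, sub_self, Pi.zero_apply]
  · intro d hd
    refine ⟨d (Fin.last n) * (x (Fin.last n))⁻¹, funext fun i => ?_⟩
    refine Fin.lastCases ?_ (fun j => ?_) i
    · simp [hx]
    · have h := congrFun hd j
      rw [hvec, Pi.zero_apply, sub_eq_zero] at h
      rw [h, Pi.smul_apply, smul_eq_mul, mul_assoc]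
end

section
/- Let K ≥ 1, let Σ ∈ ℝ^{K×K} be symmetric positive definite, let x ∈ ℝ^K, s > 0, and let m, μ ∈ ℝ^K. Then (Σ⁻¹ + s⁻¹xxᵀ)⁻¹ (s⁻¹xxᵀ m + Σ⁻¹μ) = μ + (xᵀ(m − μ)/(s + xᵀΣx)) · Σx. -/
open MeasureTheory Matrix Real

theorem posterior_mean_rank_one
    (K : ℕ) (hK : 1 ≤ K)
    (S : Matrix (Fin K) (Fin K) ℝ) (hS : S.PosDef)
    (x : Fin K → ℝ) (s : ℝ) (hs : 0 < s)
    (m μ : Fin K → ℝ) :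
    (S⁻¹ + s⁻¹ • Matrix.vecMulVec x x)⁻¹ *ᵥ
        (s⁻¹ • (Matrix.vecMulVec x x *ᵥ m) + S⁻¹ *ᵥ μ) =
      μ + ((x ⬝ᵥ (m - μ)) / (s + x ⬝ᵥ (S *ᵥ x))) • (S *ᵥ x) := by
  have hvec : (vecMulVec x x).PosSemidef := by
    simpa using posSemidef_vecMulVec_self_star x
  have hA : (S⁻¹ + s⁻¹ • vecMulVec x x).PosDef :=
    hS.inv.add_posSemidef (hvec.smul (inv_nonneg.mpr hs.le))
  have hq : 0 ≤ x ⬝ᵥ (S *ᵥ x) := by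
    simpa using hS.posSemidef.dotProduct_mulVec_nonneg x
  have hden : s + x ⬝ᵥ (S *ᵥ x) ≠ 0 := (add_pos_of_pos_of_nonneg hs hq).ne'
  have hSx : S⁻¹ *ᵥ (S *ᵥ x) = x := by
    rw [mulVec_mulVec, nonsing_inv_mul _ ((isUnit_iff_isUnit_det S).mp hS.isUnit), one_mulVec]
  have hmul : s⁻¹ • (vecMulVec x x *ᵥ m) + S⁻¹ *ᵥ μ = (S⁻¹ + s⁻¹ • vecMulVec x x) *ᵥ
      (μ + ((x ⬝ᵥ (m - μ)) / (s + x ⬝ᵥ (S *ᵥ x))) • (S *ᵥ x)) := by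
    ext i
    simp only [add_mulVec, mulVec_add, mulVec_smul, smul_mulVec, hSx, vecMulVec_mulVec,
      dotProduct_sub, Pi.add_apply, Pi.smul_apply, smul_eq_mul, op_smul_eq_smul]
    field_simp
    ring
  rw [hmul, mulVec_mulVec, nonsing_inv_mul _ ((isUnit_iff_isUnit_det _).mp hA.isUnit), one_mulVec]
end

section
/- (Closed-form invariance gap.) Let K ≥ 1, σ̂² > 0, λ̂ > 0, and m ∈ ℝ^K. Let q₀ be the Gaussian density on ℝ^K with mean m and covariance (σ̂²λ̂/(σ̂²+λ̂))·I_K, and let q_mix be the Gaussian density with mean m and covariance σ̂²·I_K − (σ̂⁴/(K(σ̂²+λ̂)))·𝟙𝟙ᵀ (which is positive definite, with eigenvalues σ̂² of multiplicity K−1 and σ̂²λ̂/(σ̂²+λ̂)). Then KL(q₀ ‖ q_mix) = ((K−1)/2)·[ ln((σ̂²+λ̂)/λ̂) + λ̂/(σ̂²+λ̂) − 1 ]. -/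
open MeasureTheory Matrix Real

open ProbabilityTheory in
theorem integrable_gaussianPDFReal_mul_pow (μ : ℝ) {v : NNReal} (hv : v ≠ 0) (n : ℕ) :
    Integrable (fun x => gaussianPDFReal μ v x * (x - μ) ^ n) := by
  have h : Integrable (fun x => (x - μ) ^ n) (gaussianReal μ v) := by
    have h1 : MemLp (fun x => x - μ) n (gaussianReal μ v) :=
      (memLp_id_gaussianReal' n (by simp)).sub (memLp_const μ)
    refine (h1.integrable_norm_pow').mono' (by fun_prop) (ae_of_all _ fun x => ?_)
    simp
  rw [gaussianReal_of_var_ne_zero μ hv,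
    integrable_withDensity_iff_integrable_smul' (measurable_gaussianPDF μ v)
      (ae_of_all _ fun _ => gaussianPDF_lt_top)] at h
  simpa using h

open ProbabilityTheory in
theorem integral_gaussianPDFReal_mul_sub (μ : ℝ) {v : NNReal} (hv : v ≠ 0) :
    ∫ x, gaussianPDFReal μ v x * (x - μ) = 0 := by
  have h := integral_gaussianReal_eq_integral_smul (μ := μ) (f := fun x => x - μ) hv
  have hid : Integrable (fun x : ℝ => x) (gaussianReal μ v) :=
    (memLp_id_gaussianReal' 1 (by simp)).integrable le_rfl
  rw [integral_sub hid (integrable_const μ)] at h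
  simpa using h.symm

open ProbabilityTheory in
theorem integral_gaussianPDFReal_mul_sub_sq (μ : ℝ) {v : NNReal} (hv : v ≠ 0) :
    ∫ x, gaussianPDFReal μ v x * (x - μ) ^ 2 = v := by
  have h := integral_gaussianReal_eq_integral_smul (μ := μ) (f := fun x => (x - μ) ^ 2) hv
  have h2 := variance_fun_id_gaussianReal (μ := μ) (v := v)
  rw [variance_eq_integral measurable_id'.aemeasurable, integral_id_gaussianReal, h] at h2
  simpa using h2

open ProbabilityTheory in
theorem integrable_integral_prod_gaussianPDFReal {ι : Type*} [Fintype ι] (m : ι → ℝ)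
    {v : NNReal} (hv : v ≠ 0) :
    Integrable (fun w : ι → ℝ => ∏ k, gaussianPDFReal (m k) v (w k)) ∧
    ∫ w : ι → ℝ, ∏ k, gaussianPDFReal (m k) v (w k) = 1 := by
  refine ⟨Integrable.fintype_prod_dep fun k => integrable_gaussianPDFReal (m k) v, ?_⟩
  rw [integral_fintype_prod_volume_eq_prod fun k => gaussianPDFReal (m k) v]
  simp [integral_gaussianPDFReal_eq_one _ hv]

open ProbabilityTheory in
theorem integrable_integral_prod_gaussianPDFReal_mul_mul {ι : Type*} [Fintype ι] [DecidableEq ι]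
    (m : ι → ℝ) {v : NNReal} (hv : v ≠ 0) (i j : ι) :
    Integrable (fun w : ι → ℝ =>
      (∏ k, gaussianPDFReal (m k) v (w k)) * ((w i - m i) * (w j - m j))) ∧
    ∫ w : ι → ℝ, (∏ k, gaussianPDFReal (m k) v (w k)) * ((w i - m i) * (w j - m j)) =
      if i = j then (v : ℝ) else 0 := by
  set e : ι → ℕ := fun k => (if k = i then 1 else 0) + (if k = j then 1 else 0) with he
  have hprod (w : ι → ℝ) : (∏ k, gaussianPDFReal (m k) v (w k)) * ((w i - m i) * (w j - m j)) =
      ∏ k, gaussianPDFReal (m k) v (w k) * (w k - m k) ^ e k := by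
    simp only [he, Finset.prod_mul_distrib, pow_add, pow_ite, pow_one, pow_zero,
      Finset.prod_ite_eq', Finset.mem_univ, if_true]
  simp_rw [hprod]
  refine ⟨Integrable.fintype_prod_dep fun k =>
    integrable_gaussianPDFReal_mul_pow (m k) hv (e k), ?_⟩
  rw [integral_fintype_prod_volume_eq_prod
    fun k x => gaussianPDFReal (m k) v x * (x - m k) ^ e k]
  split_ifs with hij
  · subst hij
    rw [Finset.prod_eq_single i]
    · simpa [he] using integral_gaussianPDFReal_mul_sub_sq (m i) hv
    · intro k _ hk
      simpa [he, hk] using integral_gaussianPDFReal_eq_one (m k) hv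
    · simp
  · refine Finset.prod_eq_zero (Finset.mem_univ i) ?_
    simpa [he, hij] using integral_gaussianPDFReal_mul_sub (m i) hv

theorem gaussian_smul_one {K : ℕ} (m w : Fin K → ℝ) {v : NNReal} (hv : v ≠ 0) :
    gaussian w m ((v : ℝ) • (1 : Matrix (Fin K) (Fin K) ℝ)) =
      ∏ k, ProbabilityTheory.gaussianPDFReal (m k) v (w k) := by
  have hv0 : (0 : ℝ) < v := by positivity
  have hinv : ((v : ℝ) • (1 : Matrix (Fin K) (Fin K) ℝ))⁻¹ = (v : ℝ)⁻¹ • 1 := by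
    apply Matrix.inv_eq_right_inv
    simp [smul_smul, hv0.ne']
  simp only [gaussian, ProbabilityTheory.gaussianPDFReal, Finset.prod_mul_distrib,
    ← Real.exp_sum, hinv]
  congr 1
  · have hsqrt : (√(2 * Real.pi * v))⁻¹ = (2 * Real.pi * v) ^ (-(1 : ℝ) / 2) := by
      rw [Real.sqrt_eq_rpow, ← Real.rpow_neg (by positivity), neg_div]
    rw [smul_smul, Matrix.det_smul, Matrix.det_one, mul_one, Finset.prod_const,
      Finset.card_univ, hsqrt, Real.rpow_pow_comm (by positivity)]
  · congr 1
    simp only [smul_mulVec, one_mulVec, dotProduct, Pi.smul_apply, Pi.sub_apply, smul_eq_mul,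
      Finset.mul_sum]
    refine Finset.sum_congr rfl fun k _ => ?_
    field_simp

theorem posDef_smul_one_add_smul_ones {K : ℕ} {a b : ℝ} (ha : 0 < a) (hb : 0 ≤ b) :
    (a • (1 : Matrix (Fin K) (Fin K) ℝ) +
      b • vecMulVec (fun _ => (1 : ℝ)) (fun _ => (1 : ℝ))).PosDef := by
  refine (Matrix.PosDef.one.smul ha).add_posSemidef (PosSemidef.smul ?_ hb)
  simpa [Pi.star_def] using posSemidef_vecMulVec_self_star (fun _ : Fin K => (1 : ℝ))

theorem det_smul_one_add_smul_ones {K : ℕ} {a : ℝ} (ha : a ≠ 0) (b : ℝ) :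
    (a • (1 : Matrix (Fin K) (Fin K) ℝ) +
      b • vecMulVec (fun _ => (1 : ℝ)) (fun _ => (1 : ℝ))).det = a ^ K * (1 + K * (b / a)) := by
  have h : a • (1 : Matrix (Fin K) (Fin K) ℝ) +
      b • vecMulVec (fun _ => (1 : ℝ)) (fun _ => (1 : ℝ)) =
      a • (1 + replicateCol Unit (fun _ => b / a) * replicateRow Unit (fun _ => (1 : ℝ))) := by
    ext i j
    simp [Matrix.mul_apply, vecMulVec_apply, mul_add, mul_div_cancel₀ _ ha]
  rw [h, det_smul, det_one_add_replicateCol_mul_replicateRow]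
  simp [dotProduct]

theorem dotProduct_smul_one_add_smul_ones_mulVec {K : ℕ} (a b : ℝ) (x : Fin K → ℝ) :
    x ⬝ᵥ ((a • (1 : Matrix (Fin K) (Fin K) ℝ) +
      b • vecMulVec (fun _ => (1 : ℝ)) (fun _ => (1 : ℝ))) *ᵥ x) =
      a * ∑ i, x i * x i + b * ∑ i, ∑ j, x i * x j := by
  rw [add_mulVec, smul_mulVec, smul_mulVec, one_mulVec, dotProduct_add, dotProduct_smul,
    dotProduct_smul]
  simp [dotProduct, mulVec, vecMulVec_apply, Finset.mul_sum]

theorem log_gaussian_div_gaussian {K : ℕ} (w m : Fin K → ℝ) {S T : Matrix (Fin K) (Fin K) ℝ}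
    (hS : 0 < S.det) (hT : 0 < T.det) :
    Real.log (gaussian w m S / gaussian w m T) =
      (Real.log T.det - Real.log S.det) / 2 + ((w - m) ⬝ᵥ (T⁻¹ *ᵥ (w - m))) / 2 -
        ((w - m) ⬝ᵥ (S⁻¹ *ᵥ (w - m))) / 2 := by
  have hp : (0 : ℝ) < (2 * Real.pi) ^ K := by positivity
  have hS' : 0 < ((2 * Real.pi) • S).det := by simpa [det_smul] using mul_pos hp hS
  have hT' : 0 < ((2 * Real.pi) • T).det := by simpa [det_smul] using mul_pos hp hT
  unfold gaussian
  rw [Real.log_div (by positivity) (by positivity), Real.log_mul (by positivity) (by positivity),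
    Real.log_mul (by positivity) (by positivity), Real.log_rpow hS', Real.log_rpow hT',
    Real.log_exp, Real.log_exp, det_smul, det_smul, Fintype.card_fin,
    Real.log_mul hp.ne' hS.ne', Real.log_mul hp.ne' hT.ne']
  ring

theorem closed_form_invariance_gap
    (K : ℕ) (hK : 1 ≤ K)
    (σ2 lam : ℝ) (hσ : 0 < σ2) (hlam : 0 < lam)
    (m : Fin K → ℝ)
    (C0 Cmix : Matrix (Fin K) (Fin K) ℝ)
    (hC0 : C0 = (σ2 * lam / (σ2 + lam)) • (1 : Matrix (Fin K) (Fin K) ℝ))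
    (hCmix : Cmix = σ2 • (1 : Matrix (Fin K) (Fin K) ℝ) -
      (σ2 ^ 2 / ((K : ℝ) * (σ2 + lam))) •
        Matrix.vecMulVec (fun _ : Fin K => (1 : ℝ)) (fun _ : Fin K => (1 : ℝ))) :
    Cmix.PosDef ∧
    (∫ w : Fin K → ℝ, gaussian w m C0 * Real.log (gaussian w m C0 / gaussian w m Cmix)) =
      ((K : ℝ) - 1) / 2 * (Real.log ((σ2 + lam) / lam) + lam / (σ2 + lam) - 1) := by
  have hK0 : (0 : ℝ) < K := by exact_mod_cast hK
  have hsum : 0 < σ2 + lam := by positivity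
  set J : Matrix (Fin K) (Fin K) ℝ := vecMulVec (fun _ => (1 : ℝ)) (fun _ => (1 : ℝ)) with hJ
  have hJJ : J * J = (K : ℝ) • J := by
    ext i j
    simp [hJ, Matrix.mul_apply, vecMulVec_apply]
  set B : Matrix (Fin K) (Fin K) ℝ := σ2⁻¹ • 1 + ((K : ℝ) * lam)⁻¹ • J with hB
  have hBC : B * Cmix = 1 := by
    have : B * Cmix = (σ2⁻¹ * σ2) • (1 : Matrix (Fin K) (Fin K) ℝ) +
        (((K : ℝ) * lam)⁻¹ * σ2 - σ2⁻¹ * (σ2 ^ 2 / ((K : ℝ) * (σ2 + lam))) -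
          ((K : ℝ) * lam)⁻¹ * (σ2 ^ 2 / ((K : ℝ) * (σ2 + lam))) * K) • J := by
      rw [hB, hCmix]
      simp only [add_mul, mul_sub, smul_mul_assoc, mul_smul_comm, hJJ, one_mul, mul_one]
      module
    rw [this, inv_mul_cancel₀ hσ.ne', one_smul, add_eq_left]
    convert zero_smul ℝ J using 2
    field_simp
    ring
  have hinv : Cmix⁻¹ = B := Matrix.inv_eq_left_inv hBC
  have hPD : Cmix.PosDef := by
    rw [← posDef_inv_iff, hinv]
    exact posDef_smul_one_add_smul_ones (by positivity) (by positivity)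
  refine ⟨hPD, ?_⟩
  obtain ⟨v, hvs⟩ : ∃ v : NNReal, (v : ℝ) = σ2 * lam / (σ2 + lam) :=
    ⟨⟨σ2 * lam / (σ2 + lam), by positivity⟩, rfl⟩
  have hv0 : (0 : ℝ) < v := by rw [hvs]; positivity
  have hv : v ≠ 0 := by exact_mod_cast hv0.ne'
  rw [← hvs] at hC0
  have hdet0 : C0.det = (v : ℝ) ^ K := by simp [hC0]
  have hdetmix : Cmix.det = σ2 ^ K * (lam / (σ2 + lam)) := by
    rw [hCmix, sub_eq_add_neg, ← neg_smul, det_smul_one_add_smul_ones hσ.ne']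
    congr 1
    field_simp
    ring
  have hinv0 : C0⁻¹ = (v : ℝ)⁻¹ • 1 + (0 : ℝ) • J := by
    rw [zero_smul, add_zero, hC0]
    apply Matrix.inv_eq_right_inv
    simp [smul_smul, hv0.ne']
  set L : ℝ := (Real.log Cmix.det - Real.log C0.det) / 2 with hL
  set q : (Fin K → ℝ) → ℝ :=
    fun w => ∏ k, ProbabilityTheory.gaussianPDFReal (m k) v (w k) with hq
  have hint (w : Fin K → ℝ) :
      gaussian w m C0 * Real.log (gaussian w m C0 / gaussian w m Cmix) =
      L * q w + ((σ2⁻¹ - (v : ℝ)⁻¹) / 2) * ∑ i, q w * ((w i - m i) * (w i - m i)) +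
        (((K : ℝ) * lam)⁻¹ / 2) * ∑ i, ∑ j, q w * ((w i - m i) * (w j - m j)) := by
    rw [log_gaussian_div_gaussian w m (by rw [hdet0]; positivity) hPD.det_pos, hinv, hinv0, hB,
      dotProduct_smul_one_add_smul_ones_mulVec, dotProduct_smul_one_add_smul_ones_mulVec, ← hL,
      hC0, gaussian_smul_one m w hv]
    simp only [← Finset.mul_sum, Pi.sub_apply, hq]
    ring
  have h0 : Integrable q ∧ ∫ w, q w = 1 := integrable_integral_prod_gaussianPDFReal m hv
  have h2 := integrable_integral_prod_gaussianPDFReal_mul_mul m hv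
  have i1 : Integrable fun w => ∑ i, q w * ((w i - m i) * (w i - m i)) :=
    integrable_finsetSum _ fun i _ => (h2 i i).1
  have i2 : Integrable fun w => ∑ i, ∑ j, q w * ((w i - m i) * (w j - m j)) :=
    integrable_finsetSum _ fun i _ => integrable_finsetSum _ fun j _ => (h2 i j).1
  have e1 : ∫ w, ∑ i, q w * ((w i - m i) * (w i - m i)) = K * v := by
    rw [integral_finsetSum _ fun i _ => (h2 i i).1]
    simp only [(h2 _ _).2]
    simp
  have e2 : ∫ w, ∑ i, ∑ j, q w * ((w i - m i) * (w j - m j)) = K * v := by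
    rw [integral_finsetSum _ fun i _ => integrable_finsetSum _ fun j _ => (h2 i j).1]
    simp_rw [integral_finsetSum _ fun j _ => (h2 _ j).1]
    simp only [(h2 _ _).2]
    simp
  have i01 : Integrable fun w =>
      L * q w + ((σ2⁻¹ - (v : ℝ)⁻¹) / 2) * ∑ i, q w * ((w i - m i) * (w i - m i)) :=
    (h0.1.const_mul L).add (i1.const_mul _)
  simp_rw [hint]
  rw [integral_add i01 (i2.const_mul _), integral_add (h0.1.const_mul L) (i1.const_mul _), integral_const_mul, integral_const_mul,
    integral_const_mul, h0.2, e1, e2]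
  have hLval : L = ((K : ℝ) - 1) / 2 * Real.log ((σ2 + lam) / lam) := by
    rw [hL, hdetmix, hdet0, hvs, Real.log_mul (by positivity) (by positivity), Real.log_pow,
      Real.log_pow, Real.log_div (by positivity) (by positivity),
      Real.log_div (by positivity) (by positivity), Real.log_div (by positivity) (by positivity),
      Real.log_mul (by positivity) (by positivity)]
    ring
  rw [hLval, hvs]
  field_simp
  ring
end

section
/- (Bound on the discrete invariance gap.) Let K ≥ 1, let q be a probability density on ℝ^K, let M ≥ 1, and let T₁, …, T_M : ℝ^K → ℝ^K be diffeomorphisms with |det DT_i(w)| = 1 for all w and with T₁ the identity map. Define q_mix(w) := (1/M)·Σ_{i=1}^M q(T_i(w)). Then q_mix is a probability density on ℝ^K, and 0 ≤ KL(q ‖ q_mix) ≤ ln M. -/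
open MeasureTheory Matrix Real

/-- A differentiable bijection with unit Jacobian preserves integrability and integrals. -/
theorem integrable_comp_and_integral_comp_of_abs_det_eq_one {K : ℕ} {q : (Fin K → ℝ) → ℝ}
    {T : (Fin K → ℝ) → (Fin K → ℝ)} (hT : Differentiable ℝ T) (hbij : Function.Bijective T)
    (hdet : ∀ w, |(fderiv ℝ T w).det| = 1) (hq : Integrable q) :
    Integrable (fun w => q (T w)) ∧ ∫ w, q (T w) = ∫ w, q w := by
  have hd : ∀ x ∈ Set.univ, HasFDerivWithinAt T (fderiv ℝ T x) Set.univ x :=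
    fun x _ => (hT x).hasFDerivAt.hasFDerivWithinAt
  have himage : T '' Set.univ = Set.univ := Set.image_univ_of_surjective hbij.surjective
  constructor
  · have h := integrableOn_image_iff_integrableOn_abs_det_fderiv_smul volume
      MeasurableSet.univ hd hbij.injective.injOn q
    simp only [himage, hdet, one_smul, integrableOn_univ] at h
    exact h.1 hq
  · have h := integral_image_eq_integral_abs_det_fderiv_smul volume
      MeasurableSet.univ hd hbij.injective.injOn q
    simp only [himage, hdet, one_smul, setIntegral_univ] at h
    exact h.symm

/-- The tangent-line lower bound for the integrand of the Kullback-Leibler divergence. -/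
theorem sub_le_mul_log_div {a b : ℝ} (ha : 0 ≤ a) (hb : 0 ≤ b) (hab : b = 0 → a = 0) :
    a - b ≤ a * Real.log (a / b) := by
  rcases ha.eq_or_lt with rfl | ha
  · simpa using hb
  have hb : 0 < b := hb.lt_of_ne fun h => ha.ne' (hab h.symm)
  calc a - b = a * (1 - (a / b)⁻¹) := by field_simp
    _ ≤ a * Real.log (a / b) :=
      mul_le_mul_of_nonneg_left (Real.one_sub_inv_le_log_of_pos (div_pos ha hb)) ha.le

/-- A bounded density ratio bounds the integrand of the Kullback-Leibler divergence. -/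
theorem mul_log_div_le_mul_log {a b c : ℝ} (ha : 0 ≤ a) (hb : 0 ≤ b) (h : a ≤ c * b) :
    a * Real.log (a / b) ≤ a * Real.log c := by
  rcases ha.eq_or_lt with rfl | ha
  · simp
  have hb : 0 < b := hb.lt_of_ne (by rintro rfl; linarith)
  exact mul_le_mul_of_nonneg_left
    (Real.log_le_log (div_pos ha hb) ((div_le_iff₀ hb).2 h)) ha.le

theorem discrete_invariance_gap_bound
    (K M : ℕ) (hK : 1 ≤ K) (hM : 1 ≤ M)
    (q : (Fin K → ℝ) → ℝ) (hq0 : ∀ w, 0 ≤ q w) (hqm : Measurable q)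
    (hq1 : ∫ w : Fin K → ℝ, q w = 1)
    (T : Fin M → (Fin K → ℝ) → (Fin K → ℝ))
    (hT_smooth : ∀ i, ContDiff ℝ 1 (T i))
    (hT_bij : ∀ i, Function.Bijective (T i))
    (hT_inv_smooth : ∀ i, ContDiff ℝ 1 (Function.invFun (T i)))
    (hT_det : ∀ i w, |(fderiv ℝ (T i) w).det| = 1)
    (hT_one : T ⟨0, hM⟩ = id)
    (qmix : (Fin K → ℝ) → ℝ)
    (hqmix : ∀ w, qmix w = (1 / (M : ℝ)) * ∑ i, q (T i w)) :
    (∀ w, 0 ≤ qmix w) ∧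
    (∫ w : Fin K → ℝ, qmix w = 1) ∧
    (0 ≤ ∫ w : Fin K → ℝ, q w * Real.log (q w / qmix w)) ∧
    (∫ w : Fin K → ℝ, q w * Real.log (q w / qmix w)) ≤ Real.log (M : ℝ) := by
  have hq : Integrable q := .of_integral_ne_zero (by simp [hq1])
  have hcomp i := integrable_comp_and_integral_comp_of_abs_det_eq_one
    ((hT_smooth i).differentiable one_ne_zero) (hT_bij i) (hT_det i) hq
  have hM0 : (0 : ℝ) < M := by exact_mod_cast hM
  obtain rfl : qmix = fun w => (1 / (M : ℝ)) * ∑ i, q (T i w) := funext hqmix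
  set qmix := fun w => (1 / (M : ℝ)) * ∑ i, q (T i w) with hqmix_def
  have hmix0 : ∀ w, 0 ≤ qmix w := fun w =>
    mul_nonneg (by positivity) (Finset.sum_nonneg fun i _ => hq0 _)
  have hmix : Integrable qmix :=
    (integrable_finsetSum _ fun i _ => (hcomp i).1).const_mul _
  have hmix1 : ∫ w, qmix w = 1 := by
    rw [hqmix_def, integral_const_mul, integral_finsetSum _ fun i _ => (hcomp i).1]
    simp [(hcomp _).2, hq1, hM0.ne']
  have hle : ∀ w, q w ≤ M * qmix w := fun w => by
    have h := Finset.single_le_sum (f := fun i => q (T i w)) (fun i _ => hq0 _)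
      (Finset.mem_univ ⟨0, hM⟩)
    simp only [hT_one, id_eq] at h
    simp only [hqmix_def]
    rwa [← mul_assoc, mul_one_div_cancel hM0.ne', one_mul]
  have hlower : ∀ w, q w - qmix w ≤ q w * Real.log (q w / qmix w) := fun w =>
    sub_le_mul_log_div (hq0 w) (hmix0 w) fun h =>
      le_antisymm (by simpa [h] using hle w) (hq0 w)
  have hupper : ∀ w, q w * Real.log (q w / qmix w) ≤ q w * Real.log M := fun w =>
    mul_log_div_le_mul_log (hq0 w) (hmix0 w) (hle w)
  have hmeas : AEStronglyMeasurable (fun w => q w * Real.log (q w / qmix w)) :=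
    (hqm.aemeasurable.mul
      (Real.measurable_log.comp_aemeasurable
        (hqm.aemeasurable.div hmix.aemeasurable))).aestronglyMeasurable
  have hint : Integrable fun w => q w * Real.log (q w / qmix w) :=
    integrable_of_le_of_le hmeas (ae_of_all _ hlower) (ae_of_all _ hupper)
      (hq.sub hmix) (hq.mul_const _)
  refine ⟨hmix0, hmix1, ?_, ?_⟩
  · calc (0 : ℝ) = ∫ w, (q w - qmix w) := by rw [integral_sub hq hmix, hq1, hmix1, sub_self]
      _ ≤ _ := integral_mono (hq.sub hmix) hint hlower
  · calc _ ≤ ∫ w, q w * Real.log M := integral_mono hint (hq.mul_const _) hupper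
      _ = Real.log M := by rw [integral_mul_const, hq1, one_mul]
end

section
/- (Data-related bound on the KL regularizer.) Let P ≥ 1, N ≥ 1, σ_y² > 0, let x₁, …, x_N be inputs and y₁, …, y_N ∈ ℝ targets, and let f(x_n; ·) : ℝ^P → ℝ be measurable for each n. Let p be a probability density on ℝ^P (the prior) with ∫ f(x_n; w) p(w) dw = 0 and σ_L²(x_n) := ∫ f(x_n; w)² p(w) dw < ∞ for each n. Define the log-likelihood ln L(w) := Σ_{n=1}^N [ −(y_n − f(x_n; w))²/(2σ_y²) − (1/2)ln(2πσ_y²) ], the expected log-likelihood ELL(q) := ∫ q(w) ln L(w) dw, and ELBO(q) := ELL(q) − KL(q ‖ p). Then ELL(p) = −Σ_{n=1}^N (σ_L²(x_n) + y_n²)/(2σ_y²) − (N/2) ln(2πσ_y²), and for every probability density q on ℝ^P with KL(q ‖ p) < ∞, ELL(q) absolutely convergent, and ELBO(q) ≥ ELBO(p), one has KL(q ‖ p) ≤ Σ_{n=1}^N (σ_L²(x_n) + y_n²)/(2σ_y²). -/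
open MeasureTheory Matrix Real

theorem data_related_kl_bound
    (P N : ℕ) (hP : 1 ≤ P) (hN : 1 ≤ N)
    (σy2 : ℝ) (hσ : 0 < σy2)
    (y : Fin N → ℝ)
    -- `f n w` is the network output `f(xₙ; w)` at the `n`-th input
    (f : Fin N → (Fin P → ℝ) → ℝ) (hf : ∀ n, Measurable (f n))
    -- the prior density, with centred outputs and finite output second moments
    (p : (Fin P → ℝ) → ℝ) (hp0 : ∀ w, 0 ≤ p w) (hpm : Measurable p)
    (hp1 : ∫ w : Fin P → ℝ, p w = 1)
    (hf_int : ∀ n, Integrable (fun w : Fin P → ℝ => f n w * p w))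
    (hf_mean : ∀ n, ∫ w : Fin P → ℝ, f n w * p w = 0)
    (hf2_int : ∀ n, Integrable (fun w : Fin P → ℝ => (f n w) ^ 2 * p w))
    (σL2 : Fin N → ℝ) (hσL2 : ∀ n, σL2 n = ∫ w : Fin P → ℝ, (f n w) ^ 2 * p w)
    -- the log-likelihood
    (lnL : (Fin P → ℝ) → ℝ)
    (hlnL : ∀ w, lnL w =
      ∑ n, (-(y n - f n w) ^ 2 / (2 * σy2) - (1 / 2) * Real.log (2 * Real.pi * σy2))) :
    (∫ w : Fin P → ℝ, p w * lnL w =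
      -(∑ n, (σL2 n + (y n) ^ 2) / (2 * σy2)) - (N : ℝ) / 2 * Real.log (2 * Real.pi * σy2)) ∧
    ∀ q : (Fin P → ℝ) → ℝ,
      (∀ w, 0 ≤ q w) → Measurable q → (∫ w : Fin P → ℝ, q w = 1) →
      Integrable (fun w : Fin P → ℝ => q w * Real.log (q w / p w)) →
      Integrable (fun w : Fin P → ℝ => q w * lnL w) →
      ((∫ w : Fin P → ℝ, q w * lnL w) - (∫ w : Fin P → ℝ, q w * Real.log (q w / p w)) ≥
        (∫ w : Fin P → ℝ, p w * lnL w) - (∫ w : Fin P → ℝ, p w * Real.log (p w / p w))) →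
      (∫ w : Fin P → ℝ, q w * Real.log (q w / p w)) ≤
        ∑ n, (σL2 n + (y n) ^ 2) / (2 * σy2) := by
  have hp_int : Integrable p := .of_integral_ne_zero (by rw [hp1]; exact one_ne_zero)
  have hELL : ∫ w : Fin P → ℝ, p w * lnL w =
      -(∑ n, (σL2 n + (y n) ^ 2) / (2 * σy2)) - (N : ℝ) / 2 * Real.log (2 * Real.pi * σy2) := by
    set c := (1 / 2) * Real.log (2 * Real.pi * σy2) with hc
    have hlnL' : ∀ w, p w * lnL w = ∑ n, (-(1 / (2 * σy2)) * ((f n w) ^ 2 * p w) +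
        y n / σy2 * (f n w * p w) + (-((y n) ^ 2 / (2 * σy2)) - c) * p w) := by
      intro w
      rw [hlnL, Finset.mul_sum]
      refine Finset.sum_congr rfl fun n _ => ?_
      field_simp
      ring
    have hsq (n : Fin N) := (hf2_int n).const_mul (-(1 / (2 * σy2)))
    have hlin (n : Fin N) := (hf_int n).const_mul (y n / σy2)
    have hconst (n : Fin N) := hp_int.const_mul (-((y n) ^ 2 / (2 * σy2)) - c)
    simp_rw [hlnL']
    rw [integral_finsetSum _ (by exact fun n _ => ((hsq n).add (hlin n)).add (hconst n))]
    have hterm : ∀ n, ∫ w : Fin P → ℝ, (-(1 / (2 * σy2)) * ((f n w) ^ 2 * p w) +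
        y n / σy2 * (f n w * p w) + (-((y n) ^ 2 / (2 * σy2)) - c) * p w) =
        -((σL2 n + (y n) ^ 2) / (2 * σy2)) - c := by
      intro n
      rw [integral_add (by exact (hsq n).add (hlin n)) (hconst n), integral_add (hsq n) (hlin n),
        integral_const_mul, integral_const_mul, integral_const_mul, hp1, hf_mean, ← hσL2]
      ring
    simp_rw [hterm]
    rw [Finset.sum_sub_distrib, Finset.sum_neg_distrib, Finset.sum_const, Finset.card_univ,
      Fintype.card_fin, nsmul_eq_mul, hc]
    ring
  refine ⟨hELL, fun q hq0 _ hq1 _ hq_ell hELBO => ?_⟩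
  have hq_int : Integrable q := .of_integral_ne_zero (by rw [hq1]; exact one_ne_zero)
  have hlnL_le : ∀ w, lnL w ≤ -((N : ℝ) / 2 * Real.log (2 * Real.pi * σy2)) := by
    intro w
    calc lnL w ≤ ∑ _n : Fin N, -((1 / 2) * Real.log (2 * Real.pi * σy2)) := by
          rw [hlnL]
          refine Finset.sum_le_sum fun n _ => ?_
          have : 0 ≤ (y n - f n w) ^ 2 / (2 * σy2) := by positivity
          rw [neg_div]
          linarith
      _ = _ := by
          rw [Finset.sum_const, Finset.card_univ, Fintype.card_fin, nsmul_eq_mul]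
          ring
  have hELL_le : ∫ w : Fin P → ℝ, q w * lnL w ≤
      -((N : ℝ) / 2 * Real.log (2 * Real.pi * σy2)) := by
    refine (integral_mono hq_ell (hq_int.mul_const _)
      fun w => mul_le_mul_of_nonneg_left (hlnL_le w) (hq0 w)).trans_eq ?_
    rw [integral_mul_const, hq1, one_mul]
  have hKL_self : ∫ w : Fin P → ℝ, p w * Real.log (p w / p w) = 0 := by simp
  rw [hKL_self, hELL] at hELBO
  linarith
end
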